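/- arXiv:1304.5020 — 6 statements merged into one kernel-verified Lean document; each statement's English description precedes it below -/
import Mathlib

section
/- (Lemma 1) There are no integers $a$, $b$, $n$ with $a$ and $b$ both even, $a > b \geq 2$, and $n \geq 1$, satisfying the Diophantine equation $3^a + 3^b + 2 = n^5$. -/
/-- An even power of three is congruent to one modulo eight. -/
theorem three_pow_even_mod_eight (a : ℕ) (ha : Even a) : 3 ^ a % 8 = 1 := by
  obtain ⟨k, rfl⟩ := ha
  rw [← two_mul, pow_mul, Nat.pow_mod]
  norm_num

/-- A fifth power is never congruent to four modulo eight. -/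
theorem fifth_pow_mod_eight (n : ℕ) : n ^ 5 % 8 ≠ 4 := by
  rw [Nat.pow_mod]
  have h : n % 8 < 8 := Nat.mod_lt _ (by norm_num)
  interval_cases n % 8 <;> norm_num

theorem stmt_4 :
    ¬ ∃ a b n : ℕ, Even a ∧ Even b ∧ a > b ∧ b ≥ 2 ∧ n ≥ 1 ∧
      3 ^ a + 3 ^ b + 2 = n ^ 5 := by
  rintro ⟨a, b, n, ha, hb, -, -, -, h⟩
  have h1 := three_pow_even_mod_eight a ha
  have h2 := three_pow_even_mod_eight b hb
  have h3 := fifth_pow_mod_eight n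
  omega
end

section
/- (Lemma 2) There are no integers $a$, $b$, $n$ with $a$ even, $b$ odd, $a > b \geq 1$, and $n \geq 1$, satisfying the Diophantine equation $3^a + 3^b + 2 = n^5$. -/
theorem stmt_5 :
    ¬ ∃ a b n : ℕ, Even a ∧ Odd b ∧ a > b ∧ b ≥ 1 ∧ n ≥ 1 ∧
      3 ^ a + 3 ^ b + 2 = n ^ 5 := by
  rintro ⟨a, b, n, ⟨k, rfl⟩, ⟨m, rfl⟩, -, -, -, h⟩
  -- Modulo 4 the left side is 1 + 3 + 2 = 2, which is not a fifth power.
  have h4 : ((3 ^ (k + k) + 3 ^ (2 * m + 1) + 2 : ℕ) : ZMod 4) = ((n ^ 5 : ℕ) : ZMod 4) := by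
    rw [h]
  push_cast at h4
  have h9 : (3 : ZMod 4) ^ 2 = 1 := by decide
  rw [← two_mul, pow_succ, pow_mul, pow_mul, h9, one_pow, one_pow] at h4
  generalize (n : ZMod 4) = x at h4
  revert x
  decide
end

section
/- (Corollary 1) There are no integers $a$, $b$, $n$ with $a$ odd, $b$ even, $a > b \geq 2$, and $n \geq 1$, satisfying the Diophantine equation $3^a + 3^b + 2 = n^5$. -/
theorem stmt_6 :
    ¬ ∃ a b n : ℕ, Odd a ∧ Even b ∧ a > b ∧ b ≥ 2 ∧ n ≥ 1 ∧
      3 ^ a + 3 ^ b + 2 = n ^ 5 := by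
  rintro ⟨a, b, n, ⟨k, rfl⟩, ⟨m, rfl⟩, -, -, -, h⟩
  have h' : (3 : ZMod 4) ^ (2 * k + 1) + 3 ^ (m + m) + 2 = (n : ZMod 4) ^ 5 := by
    exact_mod_cast congrArg (Nat.cast : ℕ → ZMod 4) h
  have e : (3 : ZMod 4) ^ 2 = 1 := by decide
  rw [← two_mul, pow_succ, pow_mul, pow_mul, e, one_pow, one_pow] at h'
  generalize (n : ZMod 4) = x at h'
  revert x
  decide
end

section
/- If positive integers $a > b > 0$ and $n \geq 1$ satisfy the Diophantine equation $3^a + 3^b + 2 = n^5$, then both $a$ and $b$ are odd. -/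
theorem pow_three_even_mod (k : ℕ) : 3 ^ (k + k) % 8 = 1 := by
  rw [← two_mul, pow_mul, Nat.pow_mod]; norm_num

theorem pow_three_odd_mod (k : ℕ) : 3 ^ (2 * k + 1) % 8 = 3 := by
  rw [pow_succ, pow_mul, Nat.mul_mod, Nat.pow_mod]; norm_num

theorem pow_five_mod (n : ℕ) : n ^ 5 % 8 = 0 ∨ n ^ 5 % 2 = 1 := by
  rcases Nat.even_or_odd n with ⟨k, rfl⟩ | hodd
  · left
    have : (k + k) ^ 5 = 8 * (4 * k ^ 5) := by ring
    omega
  · right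
    exact Nat.odd_iff.mp hodd.pow

theorem stmt_7 (a b n : ℕ) (hab : a > b) (hb : b > 0) (hn : n ≥ 1)
    (h : 3 ^ a + 3 ^ b + 2 = n ^ 5) : Odd a ∧ Odd b := by
  have h5 := pow_five_mod n
  rcases Nat.even_or_odd a with ⟨k, hk⟩ | ha <;> rcases Nat.even_or_odd b with ⟨l, hl⟩ | hb'
  · have h1 := pow_three_even_mod k
    have h2 := pow_three_even_mod l
    rw [← hk] at h1
    rw [← hl] at h2
    omega
  · obtain ⟨l, hl⟩ := hb'
    have h1 := pow_three_even_mod k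
    have h2 := pow_three_odd_mod l
    rw [← hk] at h1
    rw [← hl] at h2
    omega
  · obtain ⟨k, hk⟩ := ha
    have h1 := pow_three_odd_mod k
    have h2 := pow_three_even_mod l
    rw [← hk] at h1
    rw [← hl] at h2
    omega
  · exact ⟨ha, hb'⟩
end

section
/- (Theorem 1) The Diophantine equation $3^a + 3^b + 2 = n^5$, with $a > b > 0$ and $\gcd(n,3) = 1$, has no solution in positive integers with $2 < n \leq 2 + 6 \cdot 10^6$. -/
/-- Fifth powers `N` satisfy `N ^ k ≡ 0, 1` modulo a prime `p = 5 k + 1`; this is the test. -/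
def fifthTest (p k N : ℕ) : Bool := Nat.ble ((N % p) ^ k % p) 1

def primeList : List (ℕ × ℕ) :=
  [(11,2),(31,6),(41,8),(61,12)]

theorem fifthTest_pow (n : ℕ) : ∀ q ∈ primeList, fifthTest q.1 q.2 (n ^ 5) = true := by
  have key : ∀ q ∈ primeList, ∀ r < q.1, fifthTest q.1 q.2 (r ^ 5) = true := by
    decide +kernel
  have hpos : ∀ q ∈ primeList, 0 < q.1 := by decide +kernel
  intro q hq
  have h := key q hq (n % q.1) (Nat.mod_lt _ (hpos q hq))
  unfold fifthTest at h ⊢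
  rwa [Nat.pow_mod n 5]

theorem exclude : ∀ a < 72, ∀ b < a, 0 < b → ¬ (a = 3 ∧ b = 1) →
    ¬ ∀ q ∈ primeList, fifthTest q.1 q.2 (3 ^ a + 3 ^ b + 2) = true := by
  decide +kernel

theorem stmt_10 :
    ¬ ∃ a b n : ℕ, a > b ∧ b > 0 ∧ Nat.gcd n 3 = 1 ∧ 2 < n ∧ n ≤ 2 + 6 * 10 ^ 6 ∧
      3 ^ a + 3 ^ b + 2 = n ^ 5 := by
  rintro ⟨a, b, n, hab, hb, -, hn, hN, h⟩
  have ha : a < 72 := by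
    by_contra hc
    have h3 : 0 < 3 ^ b := by positivity
    have h1 : 3 ^ 72 ≤ 3 ^ a := Nat.pow_le_pow_right (by norm_num) (not_lt.mp hc)
    have h2 : n ^ 5 ≤ (2 + 6 * 10 ^ 6) ^ 5 := Nat.pow_le_pow_left hN 5
    norm_num at h1 h2
    omega
  refine exclude a ha b hab hb ?_ ?_
  · rintro ⟨rfl, rfl⟩
    have h2 : 3 ^ 5 ≤ n ^ 5 := Nat.pow_le_pow_left hn 5
    norm_num at h h2
    omega
  · rw [h]
    exact fifthTest_pow n
end

section
/- For every integer $j$ with $1 \leq j \leq 10^6$, the number of non-zero digits in the base-3 expansion of $(6j+2)^5$ is strictly greater than $3$. -/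
/-- `γ₃ m` is the number of non-zero digits in the ternary (base-3) expansion of `m`. -/
def γ₃ (m : ℕ) : ℕ := ((Nat.digits 3 m).filter (· ≠ 0)).length

/-- Number of non-zero digits among the lowest `k` ternary digits of `m`. -/
def lowCount : ℕ → ℕ → ℕ
  | 0, _ => 0
  | k + 1, m => (if m % 3 = 0 then 0 else 1) + lowCount k (m / 3)

theorem lowCount_le (k m : ℕ) : lowCount k m ≤ γ₃ m := by
  induction k generalizing m with
  | zero => simp [lowCount]
  | succ k ih =>
    rcases Nat.eq_zero_or_pos m with rfl | hm
    · have h := ih 0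
      simpa [lowCount] using h
    · have h := ih (m / 3)
      unfold γ₃ at h ⊢
      rw [Nat.digits_def' (by norm_num) hm, lowCount]
      by_cases h0 : m % 3 = 0
      · simpa [List.filter_cons, h0] using h
      · simp only [List.filter_cons, h0, if_false, ne_eq, not_false_eq_true, decide_true,
          if_true, List.length_cons]
        simp only [ne_eq] at h
        omega

theorem lowCount_mod (k m : ℕ) : lowCount k (m % 3 ^ k) = lowCount k m := by
  induction k generalizing m with
  | zero => simp [lowCount]
  | succ k ih =>
    have h1 : m % 3 ^ (k + 1) % 3 = m % 3 :=
      Nat.mod_mod_of_dvd _ (dvd_pow_self 3 (Nat.succ_ne_zero k))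
    have h2 : m % 3 ^ (k + 1) / 3 = m / 3 % 3 ^ k := by
      rw [pow_succ', Nat.mod_mul_right_div_self]
    rw [lowCount, lowCount, h1, h2, ih]

/-- Search over residues modulo `3 ^ k`, pruning as soon as four non-zero digits are forced. -/
def search : ℕ → ℕ → ℕ → Bool
  | 0, _, r => Nat.ble r 2 || (Nat.blt 6000002 r || (Nat.beq (r % 2) 1 ||
      Nat.blt 3 (lowCount 80 (r ^ 5))))
  | f + 1, k, r => Nat.blt 3 (lowCount k (r ^ 5)) ||
      (search f (k + 1) r && (search f (k + 1) (r + 3 ^ k) && search f (k + 1) (r + 2 * 3 ^ k)))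

theorem search_sound (f k r n : ℕ) (hs : search f k r = true) (hr : n % 3 ^ k = r)
    (hn : n < 3 ^ (k + f)) (h2 : 2 < n) (hb : n ≤ 6000002) (he : n % 2 = 0) :
    3 < γ₃ (n ^ 5) := by
  induction f generalizing k r with
  | zero =>
    have hrn : r = n := by rw [← hr]; exact Nat.mod_eq_of_lt hn
    subst hrn
    simp only [search, Bool.or_eq_true, Nat.ble_eq, Nat.blt_eq, Nat.beq_eq] at hs
    have := lowCount_le 80 (r ^ 5)
    omega
  | succ f ih =>
    simp only [search, Bool.or_eq_true, Bool.and_eq_true, Nat.blt_eq] at hs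
    rcases hs with hs | ⟨ha, hb', hc⟩
    · have h := lowCount_le k (n ^ 5)
      have e : lowCount k (r ^ 5) = lowCount k (n ^ 5) := by
        rw [← lowCount_mod k (r ^ 5), ← lowCount_mod k (n ^ 5), ← hr, ← Nat.pow_mod]
      omega
    · have hn' : n < 3 ^ (k + 1 + f) := by
        rwa [show k + 1 + f = k + (f + 1) by omega]
      have e : n % 3 ^ (k + 1) = r + 3 ^ k * (n / 3 ^ k % 3) := by
        rw [Nat.mod_pow_succ, hr]
      have h3 : n / 3 ^ k % 3 < 3 := Nat.mod_lt _ (by norm_num)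
      generalize n / 3 ^ k % 3 = d at e h3
      interval_cases d
      · exact ih (k + 1) _ ha (by simpa using e) hn'
      · exact ih (k + 1) _ hb' (by simpa using e) hn'
      · exact ih (k + 1) _ hc (by rw [e, mul_comm]) hn'

theorem search_ok : search 14 1 2 = true := by decide +kernel

theorem stmt_11 (j : ℕ) (h1 : 1 ≤ j) (h2 : j ≤ 10 ^ 6) :
    3 < γ₃ ((6 * j + 2) ^ 5) := by
  norm_num at h2
  exact search_sound 14 1 2 (6 * j + 2) search_ok (by omega) (by norm_num; omega) (by omega)
    (by omega) (by omega)
end
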